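/- Let H be a real Hilbert space, C ⊆ H a nonempty closed convex set, and f : H → ℝ differentiable, strongly convex with modulus σ > 0 and with L-Lipschitz gradient (L > 0), with minimizer z⋆ over C. Let 0 < τ ≤ 1/L and let κ satisfy 1 − τσ < κ < 1. Suppose iterates are generated by z^{k+1} = Proj_C(z^k − τ(∇f(z^k) + e^k)) where the errors satisfy ‖e^k‖ ≤ b·κ^k for some b ≥ 0 and all k. Then for every K ≥ 0, ‖z^K − z⋆‖ ≤ κ^K · ( ‖z^0 − z⋆‖ + τb/(κ − 1 + τσ) ). -/

import Mathlib

open RealInnerProductSpace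

section GradientLemmas

variable {H : Type*} [NormedAddCommGroup H] [InnerProductSpace ℝ H] [CompleteSpace H]

/-- First-order lower bound for a function with monotone gradient. -/
lemma add_inner_le_of_monotone_gradient {F : H → ℝ} {G : H → H}
    (hF : ∀ x, HasGradientAt F (G x) x) (hG : ∀ x y, 0 ≤ ⟪G x - G y, x - y⟫) (x y : H) :
    F x + ⟪G x, y - x⟫ ≤ F y := by
  have hderiv : ∀ t : ℝ, HasDerivAt (fun s : ℝ => F (x + s • (y - x)))
      ⟪G (x + t • (y - x)), y - x⟫ t := fun t => by
    have hline : HasDerivAt (fun s : ℝ => x + s • (y - x)) (y - x) t := by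
      simpa using ((hasDerivAt_id t).smul_const (y - x)).const_add x
    exact (hF (x + t • (y - x))).hasFDerivAt.comp_hasDerivAt t hline
  obtain ⟨c, hc, hslope⟩ := exists_hasDerivAt_eq_slope (fun s : ℝ => F (x + s • (y - x)))
    (fun t => ⟪G (x + t • (y - x)), y - x⟫) zero_lt_one
    (fun t _ => (hderiv t).continuousAt.continuousWithinAt) (fun t _ => hderiv t)
  have hmono := hG (x + c • (y - x)) x
  rw [add_sub_cancel_left, inner_smul_right, inner_sub_left] at hmono
  have := nonneg_of_mul_nonneg_right hmono hc.1
  simp only [one_smul, zero_smul, add_zero, add_sub_cancel, sub_zero, div_one] at hslope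
  linarith

lemma hasGradientAt_half_mul_norm_sq (M : ℝ) (x : H) :
    HasGradientAt (fun y : H => M / 2 * ‖y‖ ^ 2) (M • x) x := by
  rw [hasGradientAt_iff_hasFDerivAt]
  refine ((hasStrictFDerivAt_norm_sq x).hasFDerivAt.const_mul (M / 2)).congr_fderiv ?_
  ext y
  simp
  ring

/-- Baillon–Haddad: a monotone gradient that is one-sided Lipschitz is cocoercive. -/
lemma norm_sq_gradient_sub_le {F : H → ℝ} {G : H → H} {M : ℝ} (hM : 0 ≤ M)
    (hF : ∀ x, HasGradientAt F (G x) x) (hG : ∀ x y, 0 ≤ ⟪G x - G y, x - y⟫)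
    (hG' : ∀ x y, ⟪G x - G y, x - y⟫ ≤ M * ‖x - y‖ ^ 2) (x y : H) :
    ‖G x - G y‖ ^ 2 ≤ M * ⟪G x - G y, x - y⟫ := by
  have lower := add_inner_le_of_monotone_gradient hF hG
  have upper : ∀ x d : H, F (x + d) ≤ F x + ⟪G x, d⟫ + M / 2 * ‖d‖ ^ 2 := by
    intro x d
    have h := add_inner_le_of_monotone_gradient
      (F := fun y => M / 2 * ‖y‖ ^ 2 - F y) (G := fun y => M • y - G y)
      (fun x => by
        have h1 := (hasGradientAt_half_mul_norm_sq M x).hasFDerivAt.sub (hF x).hasFDerivAt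
        rw [hasGradientAt_iff_hasFDerivAt, map_sub]
        exact h1)
      (fun x y => by
        have h1 := hG' x y
        have h2 : M • x - G x - (M • y - G y) = M • (x - y) - (G x - G y) := by
          rw [smul_sub]; abel
        rw [h2, inner_sub_left, inner_smul_left, real_inner_self_eq_norm_sq]
        simpa using h1) x (x + d)
    rw [add_sub_cancel_left, inner_sub_left, inner_smul_left, norm_add_sq_real] at h
    simp only [conj_trivial] at h
    linarith
  have key : ∀ (t : ℝ) (x y : H),
      F x + ⟪G x, y - x⟫ + (t - M / 2 * t ^ 2) * ‖G x - G y‖ ^ 2 ≤ F y := by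
    intro t x y
    have h1 := lower x (y + t • (G x - G y))
    have h2 := upper y (t • (G x - G y))
    have h3 : ⟪G x, y + t • (G x - G y) - x⟫ - ⟪G y, t • (G x - G y)⟫
        = ⟪G x, y - x⟫ + t * ‖G x - G y‖ ^ 2 := by
      rw [add_sub_right_comm, inner_add_right, add_sub_assoc, ← inner_sub_left,
        inner_smul_right, real_inner_self_eq_norm_sq]
    rw [norm_smul, mul_pow, Real.norm_eq_abs, sq_abs] at h2
    linarith
  have bound : ∀ t : ℝ, (2 * t - M * t ^ 2) * ‖G x - G y‖ ^ 2 ≤ ⟪G x - G y, x - y⟫ := by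
    intro t
    have h1 := key t x y
    have h2 := key t y x
    rw [norm_sub_rev (G y)] at h2
    rw [← neg_sub x y, inner_neg_right] at h1
    rw [inner_sub_left]
    linarith
  rcases hM.eq_or_lt with rfl | hM
  · linarith [bound 1, hG' x y]
  · have h := bound (1 / M)
    field_simp at h
    linarith

/-- A gradient step with step size at most `1 / L` on a `σ`-strongly convex function with
`L`-Lipschitz gradient contracts distances by `1 - τ * σ`. -/
lemma norm_gradient_step_sub_le {f : H → ℝ} {g : H → H} {L σ τ : ℝ}
    (hdiff : ∀ x, HasGradientAt f (g x) x)
    (hLip : ∀ x y, ‖g x - g y‖ ≤ L * ‖x - y‖)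
    (hStrong : ∀ x y, σ * ‖x - y‖ ^ 2 ≤ ⟪g x - g y, x - y⟫)
    (hτ0 : 0 < τ) (hτL : τ * L ≤ 1) (hτσ : τ * σ ≤ 1) (x y : H) :
    ‖(x - τ • g x) - (y - τ • g y)‖ ≤ (1 - τ * σ) * ‖x - y‖ := by
  have hsub : ∀ x y : H, g x - σ • x - (g y - σ • y) = (g x - g y) - σ • (x - y) :=
    fun x y => by rw [smul_sub]; abel
  have hinner : ∀ x y : H, ⟪g x - σ • x - (g y - σ • y), x - y⟫
      = ⟪g x - g y, x - y⟫ - σ * ‖x - y‖ ^ 2 := fun x y => by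
    rw [hsub, inner_sub_left, inner_smul_left, real_inner_self_eq_norm_sq]
    simp
  have hLτ : L ≤ 1 / τ := by rw [le_div_iff₀ hτ0]; linarith
  have hcoco := norm_sq_gradient_sub_le
    (F := fun x => f x - σ / 2 * ‖x‖ ^ 2) (G := fun x => g x - σ • x) (M := 1 / τ - σ)
    (by rw [sub_nonneg, le_div_iff₀ hτ0]; linarith)
    (fun x => by
      have h1 := (hdiff x).hasFDerivAt.sub (hasGradientAt_half_mul_norm_sq σ x).hasFDerivAt
      rw [hasGradientAt_iff_hasFDerivAt, map_sub]
      exact h1)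
    (fun x y => by
      rw [hinner]
      linarith [hStrong x y])
    (fun x y => by
      rw [hinner]
      have h1 : ⟪g x - g y, x - y⟫ ≤ 1 / τ * ‖x - y‖ ^ 2 := calc
        _ ≤ ‖g x - g y‖ * ‖x - y‖ := real_inner_le_norm _ _
        _ ≤ 1 / τ * ‖x - y‖ * ‖x - y‖ := by
          gcongr
          exact (hLip x y).trans (by gcongr)
        _ = _ := by ring
      linarith) x y
  set q := g x - σ • x - (g y - σ • y) with hq
  have hq0 : 0 ≤ ⟪q, x - y⟫ := by
    rw [hinner]
    linarith [hStrong x y]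
  have hstep : (x - τ • g x) - (y - τ • g y) = (1 - τ * σ) • (x - y) - τ • q := by
    rw [hq]; module
  have hcoco' : τ * ‖q‖ ^ 2 ≤ (1 - τ * σ) * ⟪q, x - y⟫ := by
    have := mul_le_mul_of_nonneg_left hcoco hτ0.le
    rwa [← mul_assoc, mul_sub, mul_one_div_cancel hτ0.ne'] at this
  refine le_of_sq_le_sq ?_ (mul_nonneg (by linarith) (norm_nonneg _))
  rw [hstep, norm_sub_sq_real, inner_smul_left, inner_smul_right, norm_smul, norm_smul,
    mul_pow, mul_pow, Real.norm_eq_abs, Real.norm_eq_abs, sq_abs, sq_abs, real_inner_comm]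
  simp only [conj_trivial]
  have h1 := mul_le_mul_of_nonneg_left hcoco' hτ0.le
  have h2 : 0 ≤ τ * ((1 - τ * σ) * ⟪q, x - y⟫) :=
    mul_nonneg hτ0.le (mul_nonneg (by linarith) hq0)
  nlinarith

end GradientLemmas

lemma inner_nonneg_of_isMinOn_convex {H : Type*} [NormedAddCommGroup H] [InnerProductSpace ℝ H]
    [CompleteSpace H] {C : Set H} (hC : Convex ℝ C) {f : H → ℝ} {g a w : H}
    (hf : HasGradientAt f g a) (hmin : IsMinOn f C a) (ha : a ∈ C) (hw : w ∈ C) :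
    0 ≤ ⟪g, w - a⟫ := by
  simpa using hmin.localize.hasFDerivWithinAt_nonneg hf.hasFDerivAt.hasFDerivWithinAt
    (sub_mem_posTangentConeAt_of_segment_subset (hC.segment_subset ha hw))

lemma inner_le_zero_of_forall_norm_sub_le {H : Type*} [NormedAddCommGroup H]
    [InnerProductSpace ℝ H] {C : Set H} (hC : Convex ℝ C) {v p w : H} (hp : p ∈ C)
    (hmin : ∀ u ∈ C, ‖p - v‖ ≤ ‖u - v‖) (hw : w ∈ C) : ⟪v - p, w - p⟫ ≤ 0 := by
  have : Nonempty C := ⟨⟨p, hp⟩⟩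
  refine (norm_eq_iInf_iff_real_inner_le_zero hC hp).1 (le_antisymm ?_ ?_) w hw
  · exact le_ciInf fun u => by
      rw [norm_sub_rev v, norm_sub_rev v]
      exact hmin u u.2
  · exact ciInf_le (f := fun u : C => ‖v - u‖)
      ⟨0, Set.forall_mem_range.2 fun _ => norm_nonneg _⟩ ⟨p, hp⟩

lemma norm_sub_le_of_inner_nonneg {H : Type*} [NormedAddCommGroup H] [InnerProductSpace ℝ H]
    {d v : H} (h : 0 ≤ ⟪v - d, d⟫) : ‖d‖ ≤ ‖v‖ := by
  rw [inner_sub_left, real_inner_self_eq_norm_sq] at h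
  have h1 := real_inner_le_norm v d
  by_contra! hlt
  nlinarith [norm_nonneg v, norm_nonneg d]

/-- **Convergence of the inexact projected gradient iteration with geometrically
decaying errors.**
Let `C` be a nonempty closed convex subset of a real Hilbert space `H`, and
`f : H → ℝ` differentiable (with gradient `g`), strongly convex with modulus
`σ > 0`, with `L`-Lipschitz gradient (`L > 0`), with minimizer `z⋆` over `C`.
Let `0 < τ ≤ 1/L` and `1 - τσ < κ < 1`. If the iterates satisfy
`z^{k+1} = Proj_C (z^k - τ (∇f(z^k) + e^k))` with `‖e^k‖ ≤ b κ^k`, then for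
every `K`, `‖z^K - z⋆‖ ≤ κ^K (‖z^0 - z⋆‖ + τ b / (κ - 1 + τσ))`. -/
theorem inexact_projected_gradient_geometric_convergence
    {H : Type*} [NormedAddCommGroup H] [InnerProductSpace ℝ H] [CompleteSpace H]
    (C : Set H) (hCne : C.Nonempty) (hCclosed : IsClosed C) (hCconv : Convex ℝ C)
    (f : H → ℝ) (g : H → H)
    (hdiff : ∀ x : H, HasGradientAt f (g x) x)
    (L σ : ℝ) (hL : 0 < L) (hσ : 0 < σ)
    (hLip : ∀ x y : H, ‖g x - g y‖ ≤ L * ‖x - y‖)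
    (hStrong : ∀ x y : H, σ * ‖x - y‖ ^ 2 ≤ ⟪g x - g y, x - y⟫)
    (zstar : H) (hzC : zstar ∈ C) (hmin : ∀ w ∈ C, f zstar ≤ f w)
    (Proj : H → H)
    (hProj : ∀ v : H, Proj v ∈ C ∧ ∀ w ∈ C, ‖Proj v - v‖ ≤ ‖w - v‖)
    (τ κ b : ℝ) (hτ0 : 0 < τ) (hτL : τ ≤ 1 / L)
    (hκlb : 1 - τ * σ < κ) (hκ1 : κ < 1) (hb : 0 ≤ b)
    (z : ℕ → H) (e : ℕ → H)
    (hiter : ∀ k, z (k + 1) = Proj (z k - τ • (g (z k) + e k)))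
    (herr : ∀ k, ‖e k‖ ≤ b * κ ^ k) :
    ∀ K : ℕ, ‖z K - zstar‖ ≤ κ ^ K * (‖z 0 - zstar‖ + τ * b / (κ - 1 + τ * σ)) := by
  have hδ : 0 < κ - 1 + τ * σ := by linarith
  rcases subsingleton_or_nontrivial H with hH | hH
  · intro K
    have hK : 0 ≤ b * κ ^ K := (norm_nonneg _).trans (herr K)
    rw [Subsingleton.elim (z K) zstar, Subsingleton.elim (z 0) zstar, sub_self, norm_zero,
      zero_add]
    have : κ ^ K * (τ * b / (κ - 1 + τ * σ)) = τ * (b * κ ^ K) / (κ - 1 + τ * σ) := by ring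
    rw [this]
    positivity
  have hσL : σ ≤ L := by
    obtain ⟨x, y, hxy⟩ := exists_pair_ne H
    have hpos : 0 < ‖x - y‖ ^ 2 := pow_pos (norm_pos_iff.2 (sub_ne_zero.2 hxy)) 2
    refine le_of_mul_le_mul_right ?_ hpos
    calc σ * ‖x - y‖ ^ 2 ≤ ⟪g x - g y, x - y⟫ := hStrong x y
      _ ≤ ‖g x - g y‖ * ‖x - y‖ := real_inner_le_norm _ _
      _ ≤ L * ‖x - y‖ * ‖x - y‖ := by gcongr; exact hLip x y
      _ = L * ‖x - y‖ ^ 2 := by ring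
  have hτL' : τ * L ≤ 1 := (le_div_iff₀ hL).1 hτL
  have hτσ : τ * σ ≤ 1 := (mul_le_mul_of_nonneg_left hσL hτ0.le).trans hτL'
  have hκ0 : 0 < κ := by linarith
  have step : ∀ k, ‖z (k + 1) - zstar‖ ≤ (1 - τ * σ) * ‖z k - zstar‖ + τ * (b * κ ^ k) := by
    intro k
    set v := z k - τ • (g (z k) + e k) with hv
    have hproj := hProj v
    rw [hiter, ← hv]
    have h1 := inner_le_zero_of_forall_norm_sub_le hCconv hproj.1 hproj.2 hzC
    have h2 := inner_nonneg_of_isMinOn_convex hCconv (hdiff zstar) hmin hzC hproj.1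
    have h3 : ‖Proj v - zstar‖ ≤ ‖v - (zstar - τ • g zstar)‖ := by
      refine norm_sub_le_of_inner_nonneg ?_
      have h4 : v - (zstar - τ • g zstar) - (Proj v - zstar) = (v - Proj v) + τ • g zstar := by
        abel
      rw [h4, inner_add_left, inner_smul_left]
      rw [← neg_sub (Proj v) zstar, inner_neg_right] at h1
      have h5 := mul_nonneg hτ0.le h2
      simp only [conj_trivial]
      linarith
    have h6 : v - (zstar - τ • g zstar)
        = ((z k - τ • g (z k)) - (zstar - τ • g zstar)) - τ • e k := by
      rw [hv, smul_add]; abel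
    calc ‖Proj v - zstar‖ ≤ ‖v - (zstar - τ • g zstar)‖ := h3
      _ ≤ ‖(z k - τ • g (z k)) - (zstar - τ • g zstar)‖ + ‖τ • e k‖ := by
        rw [h6]; exact norm_sub_le _ _
      _ ≤ (1 - τ * σ) * ‖z k - zstar‖ + τ * (b * κ ^ k) := by
        rw [norm_smul, Real.norm_of_nonneg hτ0.le]
        gcongr
        · exact norm_gradient_step_sub_le hdiff hLip hStrong hτ0 hτL' hτσ _ _
        · exact herr k
  set D := τ * b / (κ - 1 + τ * σ) with hD
  have hDmul : τ * b = (κ - 1 + τ * σ) * D := by rw [hD]; field_simp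
  intro K
  induction K with
  | zero =>
    have : 0 ≤ D := by positivity
    simpa using this
  | succ k ih =>
    calc ‖z (k + 1) - zstar‖ ≤ (1 - τ * σ) * ‖z k - zstar‖ + τ * (b * κ ^ k) := step k
      _ ≤ (1 - τ * σ) * (κ ^ k * (‖z 0 - zstar‖ + D)) + κ ^ k * ((κ - 1 + τ * σ) * D) := by
        rw [← hDmul]
        have := mul_le_mul_of_nonneg_left ih (sub_nonneg.2 hτσ)
        linarith
      _ = κ ^ k * ((1 - τ * σ) * ‖z 0 - zstar‖ + κ * D) := by ring
      _ ≤ κ ^ k * (κ * ‖z 0 - zstar‖ + κ * D) := by gcongr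
      _ = κ ^ (k + 1) * (‖z 0 - zstar‖ + D) := by ring
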